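/- (Claim 5, second part: asymptotic equivalence to stratified DISCount) Let F̂_{kDIS,n}(S) be the k-DISCount estimator with n i.i.d. samples from ḡ_Ω and let F̂_{DIS,m}(S) be the DISCount estimator with m i.i.d. samples from ḡ_S, so Var(F̂_{DIS,m}(S)) = G(S)² σ²(S)/m. Suppose 0 < p(S) < 1 and σ²(S) > 0. Then lim_{n → ∞} Var(F̂_{kDIS,n}(S)) / Var(F̂_{DIS,⌈n·p(S)⌉}(S)) = 1. -/

import Mathlib

open Finset Filter

noncomputable section

variable {Ω : Type*} [Fintype Ω] [DecidableEq Ω]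

/-- Expectation of `X : (Fin n → Ω) → ℝ` under `n` i.i.d. samples drawn from the
pmf `q` on the finite type `Ω` (the `n`-fold product measure). -/
noncomputable def iidExp (n : ℕ) (q : Ω → ℝ) (X : (Fin n → Ω) → ℝ) : ℝ :=
  ∑ v : Fin n → Ω, (∏ i, q (v i)) * X v

/-- Probability of the event `P` under `n` i.i.d. samples drawn from the pmf `q`. -/
noncomputable def iidPr (n : ℕ) (q : Ω → ℝ) (P : (Fin n → Ω) → Prop) [DecidablePred P] : ℝ :=
  iidExp n q fun v => if P v then 1 else 0

/-- Variance of `X` under `n` i.i.d. samples drawn from the pmf `q`. -/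
noncomputable def iidVar (n : ℕ) (q : Ω → ℝ) (X : (Fin n → Ω) → ℝ) : ℝ :=
  iidExp n q fun v => (X v - iidExp n q X) ^ 2

/-- `n(S)`: the number of the samples `v 0, …, v (n-1)` that land in `S`. -/
def nIn (S : Finset Ω) {n : ℕ} (v : Fin n → Ω) : ℕ :=
  (Finset.univ.filter fun i => v i ∈ S).card

/-- The `k`-DISCount estimator `F̂(S)`: equal to
`G(S) · (1/n(S)) · ∑_{i : sᵢ ∈ S} f(sᵢ)/g(sᵢ)` if `n(S) > 0`, and `0` otherwise. -/
noncomputable def kdis (S : Finset Ω) (f g : Ω → ℝ) {n : ℕ} (v : Fin n → Ω) : ℝ :=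
  if 0 < nIn S v then
    (∑ s ∈ S, g s) *
      ((nIn S v : ℝ)⁻¹ * ∑ i ∈ Finset.univ.filter (fun i => v i ∈ S), f (v i) / g (v i))
  else 0

/-- The DISCount estimator with `m` i.i.d. samples:
`F̂_{DIS,m}(S) = G(S) · (1/m) ∑ᵢ f(sᵢ)/g(sᵢ)`. -/
noncomputable def dis (S : Finset Ω) (f g : Ω → ℝ) {m : ℕ} (v : Fin m → Ω) : ℝ :=
  (∑ s ∈ S, g s) * (((m : ℝ))⁻¹ * ∑ i, f (v i) / g (v i))

set_option linter.unusedSectionVars false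

section IidExpectation

variable {n : ℕ} {q : Ω → ℝ}

lemma iidExp_add (X Y : (Fin n → Ω) → ℝ) :
    iidExp n q (fun v => X v + Y v) = iidExp n q X + iidExp n q Y := by
  simp only [iidExp, mul_add, sum_add_distrib]

lemma iidExp_const_mul (c : ℝ) (X : (Fin n → Ω) → ℝ) :
    iidExp n q (fun v => c * X v) = c * iidExp n q X := by
  simp only [iidExp, mul_sum, mul_left_comm]

lemma iidExp_sum {ι : Type*} (s : Finset ι) (X : ι → (Fin n → Ω) → ℝ) :
    iidExp n q (fun v => ∑ i ∈ s, X i v) = ∑ i ∈ s, iidExp n q (X i) := by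
  simp only [iidExp, mul_sum]
  exact sum_comm

lemma iidExp_const (hq : ∑ s, q s = 1) (c : ℝ) : iidExp n q (fun _ => c) = c := by
  rw [iidExp, ← sum_mul, ← Fintype.piFinset_univ, ← prod_univ_sum]
  simp [hq]

lemma iidExp_mono (hq : ∀ s, 0 ≤ q s) {X Y : (Fin n → Ω) → ℝ} (h : ∀ v, X v ≤ Y v) :
    iidExp n q X ≤ iidExp n q Y :=
  sum_le_sum fun v _ => mul_le_mul_of_nonneg_left (h v) (prod_nonneg fun i _ => hq (v i))

/-- Two statistics that agree on the support of the sampling distribution have the same mean. -/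
lemma iidExp_congr {X Y : (Fin n → Ω) → ℝ} (h : ∀ v, (∀ i, q (v i) ≠ 0) → X v = Y v) :
    iidExp n q X = iidExp n q Y := by
  refine sum_congr rfl fun v _ => ?_
  by_cases hv : ∀ i, q (v i) ≠ 0
  · rw [h v hv]
  · push Not at hv
    obtain ⟨i, hi⟩ := hv
    simp [prod_eq_zero (f := fun i => q (v i)) (mem_univ i) hi]

/-- Taking expectations over the `i`-th sample separately from the others. -/
lemma iidExp_succ (i : Fin (n + 1)) (X : (Fin (n + 1) → Ω) → ℝ) :
    iidExp (n + 1) q X = ∑ s, q s * iidExp n q fun v => X (i.insertNth s v) := by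
  simp only [iidExp]
  rw [← (Fin.insertNthEquiv (fun _ => Ω) i).sum_comp, Fintype.sum_prod_type]
  refine sum_congr rfl fun s _ => ?_
  rw [mul_sum]
  refine sum_congr rfl fun v _ => ?_
  simp [Fin.insertNthEquiv, Fin.prod_univ_succAbove _ i, mul_assoc]

end IidExpectation

section SampleCount

variable {n : ℕ} {q : Ω → ℝ} {S : Finset Ω}

lemma nIn_eq_sum (v : Fin n → Ω) : nIn S v = ∑ i, if v i ∈ S then 1 else 0 := by
  rw [nIn, card_filter]

lemma nIn_insertNth (i : Fin (n + 1)) (s : Ω) (v : Fin n → Ω) :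
    nIn S (i.insertNth s v : Fin (n + 1) → Ω) = nIn S v + if s ∈ S then 1 else 0 := by
  simp [nIn_eq_sum, Fin.sum_univ_succAbove _ i, add_comm]

/-- A statistic `b` of one sample which vanishes off `S` decouples from the sample count. -/
lemma iidExp_mul_nIn {b : Ω → ℝ} (hb : ∀ s ∉ S, b s = 0) (φ : ℕ → ℝ) (i : Fin (n + 1)) :
    iidExp (n + 1) q (fun v => b (v i) * φ (nIn S v)) =
      (∑ s, q s * b s) * iidExp n q fun v => φ (nIn S v + 1) := by
  rw [iidExp_succ i, sum_mul]
  refine sum_congr rfl fun s _ => ?_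
  by_cases hs : s ∈ S
  · simp [nIn_insertNth, hs, iidExp_const_mul, mul_assoc]
  · simp [hb s hs, iidExp]

lemma iidExp_mul_mul_nIn_eq_zero {a : Ω → ℝ} (ha : ∀ s ∉ S, a s = 0) (h0 : ∑ s, q s * a s = 0)
    (φ : ℕ → ℝ) {i j : Fin n} (hij : i ≠ j) :
    iidExp n q (fun v => a (v i) * a (v j) * φ (nIn S v)) = 0 := by
  obtain _ | n := n
  · exact i.elim0
  obtain ⟨k, rfl⟩ := Fin.exists_succAbove_eq hij.symm
  rw [iidExp_succ i]
  trans ∑ s, q s * a s * iidExp n q fun v => a (v k) * φ (nIn S v + 1)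
  · refine sum_congr rfl fun s _ => ?_
    by_cases hs : s ∈ S
    · simp [nIn_insertNth, hs, iidExp_const_mul, mul_assoc]
    · simp [ha s hs, iidExp]
  · rw [← sum_mul, h0, zero_mul]

/-- The size-bias identity for the binomially distributed sample count. -/
lemma iidExp_nIn_mul (φ : ℕ → ℝ) :
    iidExp (n + 1) q (fun v => (nIn S v : ℝ) * φ (nIn S v)) =
      (n + 1) * (∑ s ∈ S, q s) * iidExp n q fun v => φ (nIn S v + 1) := by
  have h (v : Fin (n + 1) → Ω) : (nIn S v : ℝ) * φ (nIn S v) =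
      ∑ i, (if v i ∈ S then (1 : ℝ) else 0) * φ (nIn S v) := by
    rw [← sum_mul, nIn_eq_sum]
    push_cast
    rfl
  simp only [h]
  rw [iidExp_sum, sum_congr rfl fun i _ =>
    iidExp_mul_nIn (q := q) (S := S) (b := fun s => if s ∈ S then 1 else 0)
      (fun s hs => by simp [hs]) φ i]
  simp [mul_assoc]

lemma iidExp_nIn_eq_zero (hq : ∑ s, q s = 1) :
    iidExp n q (fun v => if nIn S v = 0 then 1 else 0) = (1 - ∑ s ∈ S, q s) ^ n := by
  induction n with
  | zero => simp [iidExp, nIn]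
  | succ n ih =>
    rw [iidExp_succ 0]
    trans ∑ s, q s * (1 - if s ∈ S then 1 else 0) *
      iidExp n q fun v => if nIn S v = 0 then 1 else 0
    · refine sum_congr rfl fun s _ => ?_
      simp only [nIn_insertNth]
      by_cases hs : s ∈ S
      · simp [hs, iidExp]
      · simp [hs]
    · rw [← sum_mul, ih, pow_succ']
      simp [mul_sub, hq]

/-- The mean of the self-normalised sum of a centred statistic vanishes. -/
lemma iidExp_inv_nIn_mul_sum {a : Ω → ℝ} (ha : ∀ s ∉ S, a s = 0) (h0 : ∑ s, q s * a s = 0) :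
    iidExp n q (fun v => (nIn S v : ℝ)⁻¹ * ∑ i, a (v i)) = 0 := by
  obtain _ | n := n
  · simp [iidExp]
  · simp only [mul_comm _ (∑ i, _), sum_mul]
    rw [iidExp_sum]
    refine sum_eq_zero fun i _ => ?_
    rw [iidExp_mul_nIn (q := q) ha (fun k => (k : ℝ)⁻¹) i, h0, zero_mul]

/-- The second moment of the self-normalised sum of a centred statistic. -/
lemma iidExp_inv_nIn_mul_sum_sq {a : Ω → ℝ} (ha : ∀ s ∉ S, a s = 0)
    (h0 : ∑ s, q s * a s = 0) {σ2 : ℝ} (hσ : ∑ s, q s * a s ^ 2 = (∑ s ∈ S, q s) * σ2) :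
    iidExp n q (fun v => ((nIn S v : ℝ)⁻¹ * ∑ i, a (v i)) ^ 2) =
      σ2 * iidExp n q fun v => (nIn S v : ℝ)⁻¹ := by
  obtain _ | n := n
  · simp [iidExp, nIn]
  have hinv (v : Fin (n + 1) → Ω) :
      (nIn S v : ℝ)⁻¹ = (nIn S v : ℝ) * ((nIn S v : ℝ)⁻¹) ^ 2 := by
    by_cases h : (nIn S v : ℝ) = 0
    · simp [h]
    · field_simp
  have hR := iidExp_nIn_mul (n := n) (q := q) (S := S) fun k => ((k : ℝ)⁻¹) ^ 2
  simp only [← hinv] at hR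
  have hsq (v : Fin (n + 1) → Ω) : ((nIn S v : ℝ)⁻¹ * ∑ i, a (v i)) ^ 2 =
      ∑ i, ∑ j, a (v i) * a (v j) * ((nIn S v : ℝ)⁻¹) ^ 2 := by
    rw [mul_pow, sq (∑ i, a (v i)), sum_mul_sum, mul_comm, sum_mul]
    simp only [sum_mul]
  have hdiag (i : Fin (n + 1)) :
      iidExp (n + 1) q (fun v => a (v i) * a (v i) * ((nIn S v : ℝ)⁻¹) ^ 2) =
        (∑ s ∈ S, q s) * σ2 * iidExp n q fun v => (((nIn S v + 1 : ℕ) : ℝ)⁻¹) ^ 2 := by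
    rw [← hσ]
    simp only [sq (a _)]
    exact iidExp_mul_nIn (b := fun s => a s * a s) (fun s hs => by simp [ha s hs])
      (fun k => ((k : ℝ)⁻¹) ^ 2) i
  simp only [hsq, iidExp_sum]
  rw [hR, sum_congr rfl fun i _ => by
    rw [sum_eq_single i (fun j _ hj => iidExp_mul_mul_nIn_eq_zero ha h0
      (fun k => ((k : ℝ)⁻¹) ^ 2) hj.symm) (by simp), hdiag i]]
  simp only [sum_const, card_univ, Fintype.card_fin, nsmul_eq_mul]
  push_cast
  ring

end SampleCount

section Estimators

variable {n : ℕ} {q : Ω → ℝ} {S : Finset Ω}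

lemma kdis_eq (f g : Ω → ℝ) (μ : ℝ) (v : Fin n → Ω) :
    kdis S f g v = (∑ s ∈ S, g s) * (μ + (nIn S v : ℝ)⁻¹ *
      (∑ i, if v i ∈ S then f (v i) / g (v i) - μ else 0) -
        μ * if nIn S v = 0 then 1 else 0) := by
  by_cases h : nIn S v = 0
  · simp [kdis, h]
  · have h' : (nIn S v : ℝ) ≠ 0 := by exact_mod_cast h
    rw [kdis, if_pos (Nat.pos_of_ne_zero h), if_neg h, ← sum_filter, sum_sub_distrib, sum_const,
      ← nIn, nsmul_eq_mul]
    field_simp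
    ring

/-- The variance of the `k`-DISCount estimator, for any sampling distribution `q` under which the
ratio `f / g` restricted to `S` has mean `μ` and variance `σ2`. -/
lemma iidVar_kdis (hq : ∑ s, q s = 1) {f g : Ω → ℝ} {μ σ2 : ℝ}
    (hμ : ∑ s ∈ S, q s * (f s / g s - μ) = 0)
    (hσ : ∑ s ∈ S, q s * (f s / g s - μ) ^ 2 = (∑ s ∈ S, q s) * σ2) :
    iidVar n q (fun v => kdis S f g v) = (∑ s ∈ S, g s) ^ 2 *
      (σ2 * iidExp n q (fun v => (nIn S v : ℝ)⁻¹) +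
        μ ^ 2 * ((1 - ∑ s ∈ S, q s) ^ n - ((1 - ∑ s ∈ S, q s) ^ n) ^ 2)) := by
  set a : Ω → ℝ := fun s => if s ∈ S then f s / g s - μ else 0 with ha_def
  set r : ℝ := (1 - ∑ s ∈ S, q s) ^ n
  set G : ℝ := ∑ s ∈ S, g s
  set A : (Fin n → Ω) → ℝ := fun v => (nIn S v : ℝ)⁻¹ * ∑ i, a (v i) with hA_def
  set Z : (Fin n → Ω) → ℝ := fun v => if nIn S v = 0 then 1 else 0 with hZ_def
  have ha : ∀ s ∉ S, a s = 0 := fun s hs => by simp [ha_def, hs]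
  have ha0 : ∑ s, q s * a s = 0 := by simpa [ha_def] using hμ
  have haσ : ∑ s, q s * a s ^ 2 = (∑ s ∈ S, q s) * σ2 := by simpa [ha_def, ite_pow] using hσ
  have hA : iidExp n q A = 0 := iidExp_inv_nIn_mul_sum ha ha0
  have hA2 : iidExp n q (fun v => A v ^ 2) = _ := iidExp_inv_nIn_mul_sum_sq ha ha0 haσ
  have hZ : iidExp n q Z = r := iidExp_nIn_eq_zero hq
  have hmean : iidExp n q (fun v => kdis S f g v) = G * (μ - μ * r) := by
    have h (v : Fin n → Ω) : kdis S f g v = G * (μ + A v + -μ * Z v) := by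
      rw [kdis_eq f g μ]; ring
    simp only [h, iidExp_const_mul, iidExp_add, iidExp_const hq]
    rw [hA, hZ]
    ring
  have hdev (v : Fin n → Ω) : (kdis S f g v - G * (μ - μ * r)) ^ 2 =
      G ^ 2 * (A v ^ 2 + 2 * μ * r * A v + μ ^ 2 * ((1 - 2 * r) * Z v + r ^ 2)) := by
    have h : kdis S f g v = G * (μ + A v - μ * Z v) := kdis_eq f g μ v
    have hAZ : A v * Z v = 0 := by by_cases hv : nIn S v = 0 <;> simp [hA_def, hZ_def, hv]
    have hZZ : Z v * Z v = Z v := by by_cases hv : nIn S v = 0 <;> simp [hZ_def, hv]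
    rw [h]
    linear_combination G ^ 2 * (-2 * μ * hAZ + μ ^ 2 * hZZ)
  rw [iidVar, hmean]
  simp only [hdev, iidExp_const_mul, iidExp_add, iidExp_const hq]
  rw [hA, hZ, hA2]
  ring

/-- When all samples lie in `S`, the DISCount and `k`-DISCount estimators coincide. -/
lemma iidVar_dis_eq_iidVar_kdis (hq : ∀ s ∉ S, q s = 0) (f g : Ω → ℝ) :
    iidVar n q (fun v => dis S f g v) = iidVar n q (fun v => kdis S f g v) := by
  have h (v : Fin n → Ω) (hv : ∀ i, q (v i) ≠ 0) : dis S f g v = kdis S f g v := by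
    have hvS : ∀ i, v i ∈ S := fun i => by_contra fun hi => hv i (hq _ hi)
    obtain _ | n := n <;> simp [dis, kdis, nIn, hvS]
  rw [iidVar, iidVar, iidExp_congr h]
  exact iidExp_congr fun v hv => by rw [h v hv]

lemma iidExp_inv_nIn_of_support_subset (hq1 : ∑ s, q s = 1) (hq : ∀ s ∉ S, q s = 0) :
    iidExp n q (fun v => (nIn S v : ℝ)⁻¹) = (n : ℝ)⁻¹ := by
  rw [← iidExp_const (n := n) hq1 (n : ℝ)⁻¹]
  refine iidExp_congr fun v hv => ?_
  have hvS : ∀ i, v i ∈ S := fun i => by_contra fun hi => hv i (hq _ hi)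
  simp [nIn, hvS]

end Estimators

section InverseMoment

variable {n : ℕ} {q : Ω → ℝ} {S : Finset Ω}

lemma iidExp_inv_nIn_add_one_le (hq0 : ∀ s, 0 ≤ q s) (hq : ∑ s, q s = 1)
    (hp : 0 < ∑ s ∈ S, q s) :
    iidExp n q (fun v => ((nIn S v : ℝ) + 1)⁻¹) ≤ ((n + 1) * ∑ s ∈ S, q s)⁻¹ := by
  have h := iidExp_nIn_mul (n := n) (q := q) (S := S) fun k => (k : ℝ)⁻¹
  have h1 : iidExp (n + 1) q (fun v => (nIn S v : ℝ) * (nIn S v : ℝ)⁻¹) ≤ 1 :=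
    (iidExp_mono hq0 fun v => mul_inv_le_one).trans_eq (iidExp_const hq 1)
  rw [h] at h1
  push_cast at h1
  rwa [← one_div, le_div_iff₀' (by positivity)]

lemma iidExp_inv_nIn_add_one_mul_add_two_le (hq0 : ∀ s, 0 ≤ q s) (hq : ∑ s, q s = 1)
    (hp : 0 < ∑ s ∈ S, q s) :
    iidExp n q (fun v => (((nIn S v : ℝ) + 1) * ((nIn S v : ℝ) + 2))⁻¹) ≤
      ((n + 1) * (∑ s ∈ S, q s))⁻¹ * ((n + 2) * (∑ s ∈ S, q s))⁻¹ := by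
  have h := iidExp_nIn_mul (n := n) (q := q) (S := S) fun k => ((k : ℝ) * (k + 1))⁻¹
  have h1 : iidExp (n + 1) q (fun v => (nIn S v : ℝ) * ((nIn S v : ℝ) * (nIn S v + 1))⁻¹) ≤
      iidExp (n + 1) q (fun v => ((nIn S v : ℝ) + 1)⁻¹) := by
    refine iidExp_mono hq0 fun v => ?_
    rw [mul_inv, ← mul_assoc]
    exact mul_le_of_le_one_left (by positivity) mul_inv_le_one
  have h2 := h1.trans (iidExp_inv_nIn_add_one_le hq0 hq hp)
  rw [h] at h2
  push_cast at h2
  simp only [add_assoc, one_add_one_eq_two] at h2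
  rwa [← div_eq_inv_mul, le_div_iff₀' (by positivity)]

lemma mul_iidExp_inv_nIn_le (hq0 : ∀ s, 0 ≤ q s) (hq : ∑ s, q s = 1)
    (hp : 0 < ∑ s ∈ S, q s) (hn : 0 < n) :
    n * (∑ s ∈ S, q s) * iidExp n q (fun v => (nIn S v : ℝ)⁻¹) ≤
      1 + 3 / (∑ s ∈ S, q s) * (n : ℝ)⁻¹ := by
  set p := ∑ s ∈ S, q s
  have hn' : (0 : ℝ) < n := by exact_mod_cast hn
  have h1 : iidExp n q (fun v => (nIn S v : ℝ)⁻¹) ≤ iidExp n q (fun v =>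
      ((nIn S v : ℝ) + 1)⁻¹ + 3 * (((nIn S v : ℝ) + 1) * ((nIn S v : ℝ) + 2))⁻¹) := by
    refine iidExp_mono hq0 fun v => ?_
    obtain h | h := Nat.eq_zero_or_pos (nIn S v)
    · simp [h]; positivity
    · have h' : (1 : ℝ) ≤ nIn S v := by exact_mod_cast h
      rw [← sub_nonneg]
      have : ((nIn S v : ℝ) + 1)⁻¹ + 3 * (((nIn S v : ℝ) + 1) * ((nIn S v : ℝ) + 2))⁻¹ -
          (nIn S v : ℝ)⁻¹ = 2 * (nIn S v - 1) / (nIn S v * (nIn S v + 1) * (nIn S v + 2)) := by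
        field_simp
        ring
      rw [this]
      exact div_nonneg (by linarith) (by positivity)
  rw [iidExp_add, iidExp_const_mul] at h1
  have h2 := iidExp_inv_nIn_add_one_le (n := n) hq0 hq hp
  have h3 := iidExp_inv_nIn_add_one_mul_add_two_le (n := n) hq0 hq hp
  calc n * p * iidExp n q (fun v => (nIn S v : ℝ)⁻¹)
      ≤ n * p * (((n + 1) * p)⁻¹ + 3 * (((n + 1) * p)⁻¹ * ((n + 2) * p)⁻¹)) := by
        gcongr
        linarith
    _ ≤ n * p * ((n * p)⁻¹ + 3 * ((n * p)⁻¹ * (n * p)⁻¹)) := by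
        gcongr <;> linarith
    _ = 1 + 3 / p * (n : ℝ)⁻¹ := by
        field_simp

lemma le_mul_iidExp_inv_nIn (hq0 : ∀ s, 0 ≤ q s) (hq : ∑ s, q s = 1)
    (hp : 0 < ∑ s ∈ S, q s) (hn : 0 < n) :
    1 - 2 * (1 - ∑ s ∈ S, q s) ^ n ≤
      n * (∑ s ∈ S, q s) * iidExp n q (fun v => (nIn S v : ℝ)⁻¹) := by
  have hn' : (0 : ℝ) < n := by exact_mod_cast hn
  have hN : iidExp n q (fun v => (nIn S v : ℝ)) = n * ∑ s ∈ S, q s := by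
    obtain _ | n := n
    · simp at hn
    · simpa [iidExp_const hq] using iidExp_nIn_mul (n := n) (q := q) (S := S) fun _ => 1
  have hZ := iidExp_nIn_eq_zero (n := n) (S := S) hq
  set p := ∑ s ∈ S, q s
  set c : ℝ := n * p
  have hc : 0 < c := by positivity
  have h : iidExp n q (fun v => 2 + -c⁻¹ * nIn S v + -2 * if nIn S v = 0 then 1 else 0) ≤
      iidExp n q (fun v => c * (nIn S v : ℝ)⁻¹) := by
    refine iidExp_mono hq0 fun v => ?_
    obtain h | h := Nat.eq_zero_or_pos (nIn S v)
    · simp [h]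
    · have h' : (0 : ℝ) < nIn S v := by exact_mod_cast h
      rw [if_neg h.ne', ← sub_nonneg]
      have : c * (nIn S v : ℝ)⁻¹ - (2 + -c⁻¹ * nIn S v + -2 * 0) =
          (c - nIn S v) ^ 2 / (c * nIn S v) := by
        field_simp
        ring
      rw [this]
      positivity
  simp only [iidExp_add, iidExp_const_mul, iidExp_const hq, hN, hZ] at h
  linarith [inv_mul_cancel₀ hc.ne']

lemma tendsto_mul_iidExp_inv_nIn (hq0 : ∀ s, 0 ≤ q s) (hq : ∑ s, q s = 1)
    (hp : 0 < ∑ s ∈ S, q s) (hp1 : ∑ s ∈ S, q s < 1) :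
    Tendsto (fun n : ℕ => n * (∑ s ∈ S, q s) * iidExp n q (fun v => (nIn S v : ℝ)⁻¹))
      atTop (nhds 1) := by
  have hlow : Tendsto (fun n : ℕ => 1 - 2 * (1 - ∑ s ∈ S, q s) ^ n) atTop (nhds 1) := by
    simpa using ((tendsto_pow_atTop_nhds_zero_of_lt_one (sub_nonneg.2 hp1.le)
      (sub_lt_self 1 hp)).const_mul 2).const_sub 1
  have hupp : Tendsto (fun n : ℕ => 1 + 3 / (∑ s ∈ S, q s) * (n : ℝ)⁻¹) atTop (nhds 1) := by
    simpa using (tendsto_inv_atTop_nhds_zero_nat (𝕜 := ℝ)).const_mul (3 / ∑ s ∈ S, q s)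
      |>.const_add 1
  refine tendsto_of_tendsto_of_tendsto_of_le_of_le' hlow hupp ?_ ?_
  · filter_upwards [eventually_gt_atTop 0] with n hn using le_mul_iidExp_inv_nIn hq0 hq hp hn
  · filter_upwards [eventually_gt_atTop 0] with n hn using mul_iidExp_inv_nIn_le hq0 hq hp hn

end InverseMoment

lemma tendsto_ceil_mul_div {p : ℝ} (hp : 0 < p) :
    Tendsto (fun n : ℕ => (⌈(n : ℝ) * p⌉₊ : ℝ) / (n * p)) atTop (nhds 1) := by
  have h := ((tendsto_nat_ceil_mul_div_atTop hp.le).comp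
    (tendsto_natCast_atTop_atTop (R := ℝ))).div_const p
  rw [div_self hp.ne'] at h
  refine h.congr fun n => ?_
  simp [div_div, mul_comm p]

/-- **Claim 5, second part: asymptotic equivalence to stratified
DISCount.**
Let `F̂_{kDIS,n}(S)` be the k-DISCount estimator with `n` i.i.d. samples from
`ḡ_Ω` and `F̂_{DIS,m}(S)` the DISCount estimator with `m` i.i.d. samples from
`ḡ_S` (so that `Var(F̂_{DIS,m}(S)) = G(S)² σ²(S)/m`). If `0 < p(S) < 1` and
`σ²(S) > 0`, then
`lim_{n → ∞} Var(F̂_{kDIS,n}(S)) / Var(F̂_{DIS,⌈n p(S)⌉}(S)) = 1`. -/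
theorem kdiscount_asymptotically_equivalent_discount
    (S : Finset Ω) (hS : S.Nonempty) (f g : Ω → ℝ)
    (hf : ∀ s, 0 ≤ f s) (hg : ∀ s, 0 < g s)
    (qΩ : Ω → ℝ) (hqΩ : qΩ = fun s => g s / ∑ t, g t)
    (qS : Ω → ℝ) (hqS : qS = fun s => if s ∈ S then g s / ∑ t ∈ S, g t else 0)
    (p : ℝ) (hp : p = (∑ s ∈ S, g s) / ∑ s, g s) (hp0 : 0 < p) (hp1 : p < 1)
    (σ2 : ℝ)
    (hσ2 : σ2 = ∑ s ∈ S, (g s / ∑ t ∈ S, g t) *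
        (f s / g s - (∑ t ∈ S, f t) / ∑ t ∈ S, g t) ^ 2)
    (hσ2pos : 0 < σ2) :
    Tendsto
      (fun n : ℕ =>
        iidVar n qΩ (fun v => kdis S f g v) /
          iidVar ⌈(n : ℝ) * p⌉₊ qS (fun v => dis S f g v))
      atTop (nhds 1) := by
  set G := ∑ s ∈ S, g s
  set μ := (∑ t ∈ S, f t) / G
  have hGpos : 0 < G := sum_pos (fun s _ => hg s) hS
  have hTpos : 0 < ∑ t, g t := sum_pos (fun s _ => hg s) (hS.mono (subset_univ S))
  have hqΩ0 : ∀ s, 0 ≤ qΩ s := fun s => by rw [hqΩ]; exact div_nonneg (hg s).le hTpos.le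
  have hqΩ1 : ∑ s, qΩ s = 1 := by rw [hqΩ, ← sum_div, div_self hTpos.ne']
  have hqΩp : ∑ s ∈ S, qΩ s = p := by rw [hqΩ, ← sum_div, hp]
  have hqSout : ∀ s ∉ S, qS s = 0 := fun s hs => by simp [hqS, hs]
  have hqSp : ∑ s ∈ S, qS s = 1 := by
    rw [hqS, sum_congr rfl fun s hs => if_pos hs, ← sum_div, div_self hGpos.ne']
  have hqS1 : ∑ s, qS s = 1 := by
    rw [← hqSp, sum_subset (subset_univ S) fun s _ hs => hqSout s hs]
  have hqΩS : ∀ s ∈ S, qΩ s = p * qS s := fun s hs => by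
    simp only [hqΩ, hqS, hp, if_pos hs]
    field_simp
  have hμS : ∑ s ∈ S, qS s * (f s / g s - μ) = 0 := by
    have h : ∀ s ∈ S, qS s * (f s / g s - μ) = f s / G - qS s * μ := fun s hs => by
      have := (hg s).ne'
      rw [hqS]
      simp only [if_pos hs]
      field_simp
    rw [sum_congr rfl h, sum_sub_distrib, ← sum_div, ← sum_mul, hqSp, one_mul, sub_self]
  have hσS : ∑ s ∈ S, qS s * (f s / g s - μ) ^ 2 = σ2 := by
    rw [hσ2, hqS]
    exact sum_congr rfl fun s hs => by simp only [if_pos hs]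
  have hμΩ : ∑ s ∈ S, qΩ s * (f s / g s - μ) = 0 := by
    rw [← mul_zero p, ← hμS, mul_sum]
    exact sum_congr rfl fun s hs => by rw [hqΩS s hs, mul_assoc]
  have hσΩ : ∑ s ∈ S, qΩ s * (f s / g s - μ) ^ 2 = (∑ s ∈ S, qΩ s) * σ2 := by
    rw [hqΩp, ← hσS, mul_sum]
    exact sum_congr rfl fun s hs => by rw [hqΩS s hs, mul_assoc]
  have hdis (m : ℕ) (hm : 0 < m) :
      iidVar m qS (fun v => dis S f g v) = G ^ 2 * (σ2 * (m : ℝ)⁻¹) := by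
    rw [iidVar_dis_eq_iidVar_kdis hqSout, iidVar_kdis hqS1 hμS (by rw [hσS, hqSp, one_mul]),
      iidExp_inv_nIn_of_support_subset hqS1 hqSout, hqSp, sub_self, zero_pow hm.ne']
    ring
  have hkdis (n : ℕ) := iidVar_kdis (n := n) hqΩ1 hμΩ hσΩ
  have hR := tendsto_mul_iidExp_inv_nIn (S := S) hqΩ0 hqΩ1 (hqΩp ▸ hp0) (hqΩp ▸ hp1)
  simp only [hqΩp] at hkdis hR
  have hr : Tendsto (fun n : ℕ => (1 - p) ^ n) atTop (nhds 0) :=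
    tendsto_pow_atTop_nhds_zero_of_lt_one (by linarith) (by linarith)
  have hnr : Tendsto (fun n : ℕ => n * (1 - p) ^ n) atTop (nhds 0) :=
    tendsto_self_mul_const_pow_of_lt_one (by linarith) (by linarith)
  have hlim := (tendsto_ceil_mul_div hp0).mul
    (hR.add ((hnr.mul (hr.const_sub 1)).const_mul (p * μ ^ 2 / σ2)))
  simp only [zero_mul, mul_zero, add_zero, mul_one] at hlim
  refine hlim.congr' ?_
  filter_upwards [eventually_gt_atTop 0] with n hn
  have hn' : (0 : ℝ) < n := by exact_mod_cast hn
  have hm : 0 < ⌈(n : ℝ) * p⌉₊ := Nat.ceil_pos.2 (by positivity)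
  have hm' : (0 : ℝ) < ⌈(n : ℝ) * p⌉₊ := by exact_mod_cast hm
  rw [hkdis, hdis _ hm]
  field_simp
  ring
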